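/- arXiv:1406.2953 — 5 statements merged into one kernel-verified Lean document; each statement's English description precedes it below -/
import Mathlib

section
/- Let R be a commutative local ring with maximal ideal I, let A be a finitely generated R-module, and let w : A → ℕ be any weight function. Then the set Prof(A) of profiles of bases of A has a unique minimal element with respect to the componentwise partial order ⪯ on ℕ^t; moreover this minimal element is comparable to (i.e., ⪯) every element of Prof(A). Equivalently: there exists a basis B₀ of A whose profile satisfies w(B₀) ⪯ w(B) for every basis B of A, and any two bases with this property have the same profile. -/
/-- A *basis* of a module `A`: a finite generating set no proper subset of which
generates `A`. -/
def IsBasisSet (R : Type*) {A : Type*} [CommRing R] [AddCommGroup A] [Module R A]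
    (S : Finset A) : Prop :=
  Submodule.span R (S : Set A) = ⊤ ∧
    ∀ T : Finset A, T ⊂ S → Submodule.span R (T : Set A) ≠ ⊤

/-- The *profile* of a finite subset of `A` with respect to a weight function `w`:
the list of weights of its elements, sorted in non-decreasing order. -/
def weightProfile {A : Type*} (w : A → ℕ) (S : Finset A) : List ℕ :=
  (S.val.map w).sort (· ≤ ·)

/-- A linearly independent finite family in the span of another finite family is not larger. -/
theorem LinearIndepOn.card_le_of_image_subset_span {K V ι : Type*} [Field K] [AddCommGroup V]
    [Module K V] {f : ι → V} {S T : Finset ι} (hS : LinearIndepOn K f (S : Set ι))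
    (hST : f '' S ⊆ Submodule.span K (f '' (T : Set ι))) : S.card ≤ T.card := by
  classical
  have h := linearIndependent_le_span' (fun x : (S : Set ι) => f x) hS
    ((T.image f : Finset V) : Set V) (by
      rintro _ ⟨x, rfl⟩
      simpa using hST (Set.mem_image_of_mem f x.2))
  have h' : S.card ≤ (T.image f).card := by simpa using h
  exact h'.trans Finset.card_image_le

/-- Nakayama's lemma for generating sets: a set generates a finite module over a local ring iff
its image generates the reduction of the module to the residue field. -/
theorem IsLocalRing.span_residueField_image_eq_top_iff {R A : Type*} [CommRing R] [IsLocalRing R]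
    [AddCommGroup A] [Module R A] [Module.Finite R A] {S : Set A} :
    Submodule.span (IsLocalRing.ResidueField R)
      (TensorProduct.mk R (IsLocalRing.ResidueField R) A 1 '' S) = ⊤ ↔
      Submodule.span R S = ⊤ := by
  rw [← IsLocalRing.map_tensorProduct_mk_eq_top (N := Submodule.span R S), Submodule.map_span,
    ← Submodule.restrictScalars_span R (IsLocalRing.ResidueField R) Ideal.Quotient.mk_surjective,
    Submodule.restrictScalars_eq_top_iff]

/-- A finite subset of a finite module over a local ring is a minimal generating set iff it
reduces to a basis of the reduction of the module to the residue field. -/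
theorem isBasisSet_iff {R A : Type*} [CommRing R] [IsLocalRing R]
    [AddCommGroup A] [Module R A] [Module.Finite R A] {S : Finset A} :
    IsBasisSet R S ↔
      LinearIndepOn (IsLocalRing.ResidueField R)
        (TensorProduct.mk R (IsLocalRing.ResidueField R) A 1) (S : Set A) ∧
      Submodule.span (IsLocalRing.ResidueField R)
        (TensorProduct.mk R (IsLocalRing.ResidueField R) A 1 '' S) = ⊤ := by
  rw [IsBasisSet, IsLocalRing.span_residueField_image_eq_top_iff]
  constructor
  · rintro ⟨hS, hmin⟩
    refine ⟨?_, hS⟩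
    obtain ⟨T, hTS, -, hspan, hT⟩ := exists_linearIndepOn_extension
      (K := IsLocalRing.ResidueField R)
      (v := TensorProduct.mk R (IsLocalRing.ResidueField R) A 1)
      (linearIndepOn_empty _ _) (Set.empty_subset (S : Set A))
    lift T to Finset A using S.finite_toSet.subset hTS
    have hTtop : Submodule.span R (T : Set A) = ⊤ := by
      rw [← IsLocalRing.span_residueField_image_eq_top_iff, eq_top_iff,
        ← IsLocalRing.span_residueField_image_eq_top_iff.mpr hS]
      exact Submodule.span_le.mpr hspan
    have hTS' : T = S := (Finset.coe_subset.mp hTS).eq_of_not_ssubset fun h => hmin T h hTtop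
    rwa [← hTS']
  · rintro ⟨hS, htop⟩
    refine ⟨htop, fun T hT hTtop => ?_⟩
    have hcard := hS.card_le_of_image_subset_span (T := T) (by
      rw [IsLocalRing.span_residueField_image_eq_top_iff.mpr hTtop]
      exact Set.subset_univ _)
    exact hcard.not_gt (Finset.card_lt_card hT)

/-- In a family of minimal total weight that is linearly independent and spanning, the members
of weight at most `n` are at least as many as in any linearly independent family. -/
theorem LinearIndepOn.card_filter_le_of_sum_minimal {K V ι : Type*} [Field K] [AddCommGroup V]
    [Module K V] {f : ι → V} {w : ι → ℕ} {B₀ B : Finset ι}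
    (h₀ : LinearIndepOn K f (B₀ : Set ι)) (htop : Submodule.span K (f '' (B₀ : Set ι)) = ⊤)
    (hmin : ∀ S : Finset ι, LinearIndepOn K f (S : Set ι) →
      Submodule.span K (f '' (S : Set ι)) = ⊤ → ∑ x ∈ B₀, w x ≤ ∑ x ∈ S, w x)
    (hB : LinearIndepOn K f (B : Set ι)) (n : ℕ) :
    (B.filter (w · ≤ n)).card ≤ (B₀.filter (w · ≤ n)).card := by
  classical
  refine LinearIndepOn.card_le_of_image_subset_span
    (hB.mono (Finset.coe_subset.mpr (Finset.filter_subset _ _))) ?_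
  rintro _ ⟨y, hy, rfl⟩
  by_contra hspan
  have hyn : w y ≤ n := (Finset.mem_filter.mp hy).2
  obtain ⟨hind, hy₀⟩ := (LinearIndepOn.notMem_span_iff
    (h₀.mono (Finset.coe_subset.mpr (Finset.filter_subset (w · ≤ n) B₀)))).mp hspan
  have hyB₀ : y ∉ B₀ := fun h => hy₀ (Finset.mem_coe.mpr (Finset.mem_filter.mpr ⟨h, hyn⟩))
  obtain ⟨S, hSsub, hsubS, hSspan, hS⟩ := exists_linearIndepOn_extension hind
    (Set.insert_subset_insert (Finset.coe_subset.mpr (Finset.filter_subset (w · ≤ n) B₀)))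
  rw [← Finset.coe_insert] at hSsub
  lift S to Finset ι using (Finset.finite_toSet _).subset hSsub
  rw [Finset.coe_subset] at hSsub
  have hStop : Submodule.span K (f '' (S : Set ι)) = ⊤ := by
    rw [eq_top_iff, ← htop, Submodule.span_le]
    exact (Set.image_mono (Set.subset_insert _ _)).trans hSspan
  have hcard : S.card ≤ B₀.card :=
    hS.card_le_of_image_subset_span (by rw [htop]; exact Set.subset_univ _)
  obtain ⟨z, hz, hzS⟩ : ∃ z ∈ insert y B₀, z ∉ S := by
    by_contra! h
    have := Finset.card_le_card h
    rw [Finset.card_insert_of_notMem hyB₀] at this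
    omega
  have hzn : n < w z := by
    by_contra! hle
    refine hzS (hsubS ?_)
    rcases Finset.mem_insert.mp hz with rfl | hz
    · exact Set.mem_insert _ _
    · exact Set.mem_insert_of_mem _ (Finset.mem_coe.mpr (Finset.mem_filter.mpr ⟨hz, hle⟩))
  have hsum : ∑ x ∈ insert z S, w x ≤ ∑ x ∈ insert y B₀, w x :=
    Finset.sum_le_sum_of_subset (Finset.insert_subset hz hSsub)
  rw [Finset.sum_insert hzS, Finset.sum_insert hyB₀] at hsum
  have := hmin S hS hStop
  omega

/-- Sorted lists of equal length are componentwise comparable if their counting functions are. -/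
theorem List.forall₂_le_of_countP_le {l₁ l₂ : List ℕ} (h₁ : l₁.Pairwise (· ≤ ·))
    (h₂ : l₂.Pairwise (· ≤ ·)) (hlen : l₁.length = l₂.length)
    (hcount : ∀ n, l₂.countP (· ≤ n) ≤ l₁.countP (· ≤ n)) :
    List.Forall₂ (· ≤ ·) l₁ l₂ := by
  induction l₁ generalizing l₂ with
  | nil => simp_all [eq_comm]
  | cons a l₁ ih =>
    cases l₂ with
    | nil => simp at hlen
    | cons b l₂ =>
      rw [List.pairwise_cons] at h₁ h₂
      have hab : a ≤ b := by
        have hpos : 0 < (a :: l₁).countP (· ≤ b) :=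
          lt_of_lt_of_le (List.countP_pos_iff.mpr ⟨b, by simp⟩) (hcount b)
        obtain ⟨c, hc, hcb⟩ := List.countP_pos_iff.mp hpos
        rcases List.mem_cons.mp hc with rfl | hc
        · simpa using hcb
        · exact (h₁.1 c hc).trans (by simpa using hcb)
      refine .cons hab (ih h₁.2 h₂.2 (by simpa using hlen) fun n => ?_)
      by_cases hbn : b ≤ n
      · simpa [List.countP_cons, hbn, hab.trans hbn] using hcount n
      · have : l₂.countP (· ≤ n) = 0 := by
          rw [List.countP_eq_zero]
          intro c hc
          have := h₂.1 c hc
          simp only [decide_eq_true_eq]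
          omega
        omega

/-- The componentwise order on lists is antisymmetric. -/
theorem List.Forall₂.antisymm_le {α : Type*} [PartialOrder α] {l₁ l₂ : List α}
    (h : List.Forall₂ (· ≤ ·) l₁ l₂) (h' : List.Forall₂ (· ≤ ·) l₂ l₁) : l₁ = l₂ := by
  induction h with
  | nil => rfl
  | cons hab _ ih =>
    cases h' with
    | cons hba h' => rw [le_antisymm hab hba, ih h']

theorem pairwise_weightProfile {A : Type*} (w : A → ℕ) (S : Finset A) :
    (weightProfile w S).Pairwise (· ≤ ·) :=
  Multiset.pairwise_sort _ _

theorem length_weightProfile {A : Type*} (w : A → ℕ) (S : Finset A) :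
    (weightProfile w S).length = S.card := by
  simp [weightProfile]

theorem countP_weightProfile {A : Type*} (w : A → ℕ) (S : Finset A) (n : ℕ) :
    (weightProfile w S).countP (· ≤ n) = (S.filter (w · ≤ n)).card := by
  rw [← Multiset.coe_countP, weightProfile, Multiset.sort_eq, Multiset.countP_map]
  rfl

/-- A finite module has a minimal generating set. -/
theorem exists_isBasisSet (R A : Type*) [CommRing R] [AddCommGroup A] [Module R A]
    [Module.Finite R A] : ∃ S : Finset A, IsBasisSet R S := by
  obtain ⟨S, hS⟩ := Module.Finite.fg_top (R := R) (M := A)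
  obtain ⟨T, hT, hmin⟩ := WellFounded.has_min (wellFounded_lt (α := Finset A))
    {T | Submodule.span R (T : Set A) = ⊤} ⟨S, hS⟩
  exact ⟨T, hT, fun U hU htop => hmin U htop hU⟩

/-- The set of profiles of bases of a finitely generated module over a commutative
local ring has a unique minimal element with respect to the componentwise partial
order, and this minimal element is comparable to every profile of a basis. -/
theorem stmt0 {R A : Type*} [CommRing R] [IsLocalRing R] [AddCommGroup A] [Module R A]
    [Module.Finite R A] (w : A → ℕ) :
    (∃ B₀ : Finset A, IsBasisSet R B₀ ∧
      ∀ B : Finset A, IsBasisSet R B →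
        List.Forall₂ (· ≤ ·) (weightProfile w B₀) (weightProfile w B)) ∧
    (∀ B₁ B₂ : Finset A, IsBasisSet R B₁ → IsBasisSet R B₂ →
      (∀ B : Finset A, IsBasisSet R B →
        List.Forall₂ (· ≤ ·) (weightProfile w B₁) (weightProfile w B)) →
      (∀ B : Finset A, IsBasisSet R B →
        List.Forall₂ (· ≤ ·) (weightProfile w B₂) (weightProfile w B)) →
      weightProfile w B₁ = weightProfile w B₂) := by
  refine ⟨?_, fun B₁ B₂ h₁ h₂ hmin₁ hmin₂ => ?_⟩
  · obtain ⟨B₀, h₀, hmin⟩ := WellFounded.has_min (measure fun S : Finset A => ∑ x ∈ S, w x).wf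
      {S | IsBasisSet R S} (exists_isBasisSet R A)
    refine ⟨B₀, h₀, fun B hB => ?_⟩
    obtain ⟨hi₀, ht₀⟩ := isBasisSet_iff.mp h₀
    obtain ⟨hi, ht⟩ := isBasisSet_iff.mp hB
    refine List.forall₂_le_of_countP_le (pairwise_weightProfile w B₀) (pairwise_weightProfile w B)
      ?_ fun n => ?_
    · rw [length_weightProfile, length_weightProfile]
      exact le_antisymm
        (hi₀.card_le_of_image_subset_span (by rw [ht]; exact Set.subset_univ _))
        (hi.card_le_of_image_subset_span (by rw [ht₀]; exact Set.subset_univ _))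
    · rw [countP_weightProfile, countP_weightProfile]
      exact hi₀.card_filter_le_of_sum_minimal ht₀
        (fun S hS hStop => not_lt.mp (hmin S (isBasisSet_iff.mpr ⟨hS, hStop⟩))) hi n
  · exact (hmin₁ B₂ h₂).antisymm_le (hmin₂ B₁ h₁)
end

section
/- Let R be a commutative local ring with maximal ideal I, A a finitely generated R-module, w : A → ℕ a weight function, and t the common cardinality of bases of A. Suppose X = {x_1,…,x_t} and Y = {y_1,…,y_t} are bases of A ordered so that w(x_1) ≤ … ≤ w(x_t) and w(y_1) ≤ … ≤ w(y_t), and suppose there is an integer s with 0 ≤ s ≤ t−1 such that w(x_i) = w(y_i) for all i = 1,…,s and w(x_{s+1}) < w(y_{s+1}). Then there exists a basis Z = {z_1,…,z_t} of A, ordered so that w(z_1) ≤ … ≤ w(z_t), with w(z_i) ≤ w(y_i) for every i = 1,…,t and w(z_{s+1}) < w(y_{s+1}); in particular the profile of Z is strictly smaller than the profile of Y in the componentwise order. -/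
open IsLocalRing TensorProduct in
/-- Nakayama's lemma for generating sets, phrased over the residue field. -/
theorem span_eq_top_iff_span_image_tensorProduct_mk_eq_top {R A : Type*} [CommRing R]
    [IsLocalRing R] [AddCommGroup A] [Module R A] [Module.Finite R A] (S : Set A) :
    Submodule.span R S = ⊤ ↔
      Submodule.span (ResidueField R) (TensorProduct.mk R (ResidueField R) A 1 '' S) = ⊤ := by
  rw [← map_tensorProduct_mk_eq_top, Submodule.map_span,
    ← Submodule.restrictScalars_span R (ResidueField R) Ideal.Quotient.mk_surjective,
    Submodule.restrictScalars_eq_top_iff]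

open IsLocalRing TensorProduct in
/-- The residue classes of a basis form a vector space basis of the residue space. -/
theorem IsBasisSet.linearIndependent_and_span {R A ι : Type*} [CommRing R]
    [IsLocalRing R] [AddCommGroup A] [Module R A] [Module.Finite R A] [DecidableEq A]
    [Fintype ι] {y : ι → A} (hy : Function.Injective y)
    (h : IsBasisSet R (Finset.image y Finset.univ)) :
    LinearIndependent (ResidueField R) (TensorProduct.mk R (ResidueField R) A 1 ∘ y) ∧
      Submodule.span (ResidueField R)
        (Set.range (TensorProduct.mk R (ResidueField R) A 1 ∘ y)) = ⊤ := by
  classical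
  obtain ⟨h1, h2⟩ := h
  rw [span_eq_top_iff_span_image_tensorProduct_mk_eq_top, Finset.coe_image, Finset.coe_univ,
    Set.image_univ, ← Set.range_comp] at h1
  refine ⟨?_, h1⟩
  rw [linearIndependent_iff_notMem_span]
  intro i hi
  refine h2 (Finset.image y (Finset.univ.erase i))
    ((Finset.image_ssubset_image hy).2 (Finset.erase_ssubset (Finset.mem_univ i))) ?_
  rw [span_eq_top_iff_span_image_tensorProduct_mk_eq_top, eq_top_iff, ← h1, Submodule.span_le]
  rintro _ ⟨j, rfl⟩
  rw [Finset.coe_image, ← Set.image_comp, Finset.coe_erase, Finset.coe_univ]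
  by_cases hj : j = i
  · exact hj ▸ hi
  · exact Submodule.subset_span ⟨j, ⟨Set.mem_univ j, hj⟩, rfl⟩

open IsLocalRing TensorProduct in
/-- A family whose residue classes form a vector space basis is a basis. -/
theorem isBasisSet_image_of_linearIndependent_of_span {R A ι : Type*} [CommRing R]
    [IsLocalRing R] [AddCommGroup A] [Module R A] [Module.Finite R A] [DecidableEq A]
    [Fintype ι] {z : ι → A}
    (hli : LinearIndependent (ResidueField R) (TensorProduct.mk R (ResidueField R) A 1 ∘ z))
    (hsp : Submodule.span (ResidueField R)
        (Set.range (TensorProduct.mk R (ResidueField R) A 1 ∘ z)) = ⊤) :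
    IsBasisSet R (Finset.image z Finset.univ) := by
  refine ⟨?_, fun T hT hspT ↦ ?_⟩
  · rwa [span_eq_top_iff_span_image_tensorProduct_mk_eq_top, Finset.coe_image, Finset.coe_univ,
      Set.image_univ, ← Set.range_comp]
  · obtain ⟨a, ha, haT⟩ := Finset.exists_of_ssubset hT
    obtain ⟨i, -, rfl⟩ := Finset.mem_image.1 ha
    rw [span_eq_top_iff_span_image_tensorProduct_mk_eq_top] at hspT
    refine linearIndependent_iff_notMem_span.1 hli i (Submodule.span_mono ?_
      (hspT.symm ▸ Submodule.mem_top))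
    rintro _ ⟨b, hb, rfl⟩
    obtain ⟨j, -, rfl⟩ := Finset.mem_image.1 (hT.1 hb)
    exact ⟨j, ⟨Set.mem_univ j, fun hj ↦ haT (hj ▸ hb)⟩, rfl⟩

/-- Exchange: among the first `s + 1` members of a linearly independent family, one can replace
some member of index at least `s` of a given basis. -/
theorem exists_linearIndependent_update {K V : Type*} [Field K] [AddCommGroup V] [Module K V]
    {t : ℕ} {x y : Fin t → V} (hx : LinearIndependent K x) (hy : LinearIndependent K y)
    (hsp : Submodule.span K (Set.range y) = ⊤) (s : Fin t) :
    ∃ j ≤ s, ∃ i ≥ s, LinearIndependent K (Function.update y i (x j)) := by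
  have hj : ∃ j ≤ s, x j ∉ Submodule.span K (y '' Set.Iio s) := by
    by_contra! h
    have h1 := finrank_span_eq_card (hx.comp (Subtype.val : Set.Iic s → Fin t)
      Subtype.val_injective)
    have h2 := finrank_span_eq_card (hy.comp (Subtype.val : Set.Iio s → Fin t)
      Subtype.val_injective)
    rw [Set.range_comp, Subtype.range_coe] at h1 h2
    have : FiniteDimensional K (Submodule.span K (y '' Set.Iio s)) :=
      FiniteDimensional.span_of_finite K (Set.toFinite _)
    have h3 := Submodule.finrank_mono (Submodule.span_le.2 (by
      rintro _ ⟨j, hj, rfl⟩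
      exact h j hj) : Submodule.span K (x '' Set.Iic s) ≤ Submodule.span K (y '' Set.Iio s))
    rw [h1, h2, ← Set.toFinset_card, ← Set.toFinset_card, Set.toFinset_Iic, Set.toFinset_Iio,
      Fin.card_Iic, Fin.card_Iio] at h3
    exact Nat.not_succ_le_self _ h3
  obtain ⟨j, hjs, hj⟩ := hj
  let b := Module.Basis.mk hy hsp.ge
  have hi : ∃ i ≥ s, b.repr (x j) i ≠ 0 := by
    by_contra! h
    apply hj
    have hb : (b : Fin t → V) = y := Module.Basis.coe_mk _ _
    rw [← hb, b.mem_span_image]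
    intro i hi
    by_contra hi'
    exact Finsupp.mem_support_iff.1 hi (h i (not_lt.1 hi'))
  obtain ⟨i, his, hi⟩ := hi
  refine ⟨j, hjs, i, his, hy.update i (x j) ⟨1, one_mem _, b.repr (x j),
    mem_nonZeroDivisors_of_ne_zero hi, ?_⟩⟩
  have h := b.linearCombination_repr (x j)
  rw [Module.Basis.coe_mk] at h
  rw [one_smul, h]

/-- The profile of an injective family listed by weight is the list of its weights. -/
theorem weightProfile_image_of_monotone {A : Type*} [DecidableEq A] (w : A → ℕ) {t : ℕ}
    {z : Fin t → A} (hz : Function.Injective z) (hmono : Monotone (w ∘ z)) :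
    weightProfile w (Finset.image z Finset.univ) = List.ofFn (w ∘ z) := by
  rw [weightProfile, Finset.image_val_of_injOn hz.injOn, Multiset.map_map, Fin.univ_val_map,
    Multiset.coe_sort]
  exact List.mergeSort_eq_self _ (List.sortedLE_ofFn_iff.2 hmono).pairwise

theorem Tuple.comp_sort_le_of_forall_le {t : ℕ} {α : Type*} [LinearOrder α] {f : Fin t → α}
    {m : Fin t} {a : α} (h : ∀ i ≤ m, f i ≤ a) : f (Tuple.sort f m) ≤ a := by
  have h1 := Tuple.lt_card_le_iff_apply_le_of_monotone (j := m) (a := a) (Tuple.monotone_sort f)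
  refine h1.1 ?_
  have h2 : Finset.card {i | (f ∘ Tuple.sort f) i ≤ a} = Finset.card {i | f i ≤ a} :=
    Finset.card_equiv (Tuple.sort f) (by simp)
  rw [h2]
  calc (m : ℕ) < (Finset.Iic m).card := by simp
    _ ≤ _ := Finset.card_le_card fun i hi ↦ by simpa using h i (by simpa using hi)

theorem Tuple.comp_sort_lt_of_card {t : ℕ} {α : Type*} [LinearOrder α] {f : Fin t → α}
    {m : Fin t} {a : α} (h : (m : ℕ) < Finset.card {i | f i < a}) : f (Tuple.sort f m) < a := by
  have h1 := Tuple.lt_card_lt_iff_apply_lt_of_monotone (j := m) (a := a) (Tuple.monotone_sort f)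
  refine h1.1 ?_
  have h2 : Finset.card {i | (f ∘ Tuple.sort f) i < a} = Finset.card {i | f i < a} :=
    Finset.card_equiv (Tuple.sort f) (by simp)
  rwa [h2]

/-- The exchange step in the proof of the existence of a unique minimal profile:
given bases `X = {x_1,…,x_t}` and `Y = {y_1,…,y_t}` (listed in non-decreasing order
of weight) with `w(x_i) = w(y_i)` for `i ≤ s` and `w(x_{s+1}) < w(y_{s+1})`, there is
a basis `Z = {z_1,…,z_t}` (in non-decreasing order of weight) with `w(z_i) ≤ w(y_i)`
for all `i` and `w(z_{s+1}) < w(y_{s+1})`; in particular the profile of `Z` is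
strictly smaller than the profile of `Y` in the componentwise order. -/
theorem stmt1 {R A : Type*} [CommRing R] [IsLocalRing R] [AddCommGroup A] [Module R A]
    [Module.Finite R A] [DecidableEq A] (w : A → ℕ) (t s : ℕ) (hs : s < t)
    (x y : Fin t → A)
    (hxinj : Function.Injective x) (hyinj : Function.Injective y)
    (hxB : IsBasisSet R (Finset.image x Finset.univ))
    (hyB : IsBasisSet R (Finset.image y Finset.univ))
    (hxmono : Monotone (w ∘ x)) (hymono : Monotone (w ∘ y))
    (heq : ∀ i : Fin t, (i : ℕ) < s → w (x i) = w (y i))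
    (hlt : w (x ⟨s, hs⟩) < w (y ⟨s, hs⟩)) :
    ∃ z : Fin t → A, Function.Injective z ∧
      IsBasisSet R (Finset.image z Finset.univ) ∧ Monotone (w ∘ z) ∧
      (∀ i : Fin t, w (z i) ≤ w (y i)) ∧ w (z ⟨s, hs⟩) < w (y ⟨s, hs⟩) ∧
      List.Forall₂ (· ≤ ·) (weightProfile w (Finset.image z Finset.univ))
        (weightProfile w (Finset.image y Finset.univ)) ∧
      weightProfile w (Finset.image z Finset.univ) ≠
        weightProfile w (Finset.image y Finset.univ) := by
  obtain ⟨hxli, -⟩ := hxB.linearIndependent_and_span hxinj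
  obtain ⟨hyli, hysp⟩ := hyB.linearIndependent_and_span hyinj
  obtain ⟨j, hjs, i, his, hli⟩ := exists_linearIndependent_update hxli hyli hysp ⟨s, hs⟩
  rw [Function.comp_apply, ← Function.comp_update] at hli
  set z := Function.update y i (x j) with hz
  have hxy : w (x j) < w (y ⟨s, hs⟩) := (hxmono hjs).trans_lt hlt
  have hzy : ∀ l, w (z l) ≤ w (y l) := by
    intro l
    by_cases hl : l = i
    · subst hl
      simpa [hz] using hxy.le.trans (hymono his)
    · simp [hz, hl]
  have hcard : s < Finset.card {l | (w ∘ z) l < w (y ⟨s, hs⟩)} := by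
    have hi : i ∉ Finset.Iio (⟨s, hs⟩ : Fin t) := by simpa using his
    calc s < (insert i (Finset.Iio (⟨s, hs⟩ : Fin t))).card := by
          rw [Finset.card_insert_of_notMem hi]; simp
      _ ≤ _ := Finset.card_le_card fun l hl ↦ by
        rw [Finset.mem_filter_univ]
        rcases Finset.mem_insert.1 hl with rfl | hl
        · simpa [hz] using hxy
        · have hl' : l < ⟨s, hs⟩ := Finset.mem_Iio.1 hl
          exact (hzy l).trans_lt ((heq l hl').symm.trans_le (hxmono hl'.le) |>.trans_lt hlt)
  set σ := Tuple.sort (w ∘ z)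
  have hσli := hli.comp σ σ.injective
  have hmono : Monotone (w ∘ (z ∘ σ)) := Tuple.monotone_sort (w ∘ z)
  have hinj : Function.Injective (z ∘ σ) := Function.Injective.of_comp hσli.injective
  have hle : ∀ l, w ((z ∘ σ) l) ≤ w (y l) := fun l ↦
    Tuple.comp_sort_le_of_forall_le (f := w ∘ z) fun m hm ↦ (hzy m).trans (hymono hm)
  have hlt' : w ((z ∘ σ) ⟨s, hs⟩) < w (y ⟨s, hs⟩) :=
    Tuple.comp_sort_lt_of_card (f := w ∘ z) hcard
  have hrank := Module.finrank_eq_card_basis (Module.Basis.mk hyli hysp.ge)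
  refine ⟨z ∘ σ, hinj, isBasisSet_image_of_linearIndependent_of_span hσli
    (hσli.span_eq_top_of_card_eq_finrank' hrank.symm), hmono, hle, hlt', ?_, ?_⟩
  · rw [weightProfile_image_of_monotone w hinj hmono,
      weightProfile_image_of_monotone w hyinj hymono, List.forall₂_iff_get]
    exact ⟨by simp, fun l h₁ h₂ ↦ by simpa using hle ⟨l, by simpa using h₁⟩⟩
  · rw [weightProfile_image_of_monotone w hinj hmono,
      weightProfile_image_of_monotone w hyinj hymono]
    exact fun h ↦ hlt'.ne (congrFun (List.ofFn_injective h) ⟨s, hs⟩)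
end

section
/- Let R be a commutative local ring with maximal ideal I, A a finitely generated R-module, w : A → ℕ a weight function, t := dim_{R/I}(A/IA), and π : A → A/IA the natural projection. Suppose y_1,…,y_t ∈ A are chosen recursively by the following greedy rule: for each i = 1,…,t, the images π(y_1),…,π(y_i) are linearly independent over R/I, and y_i has minimal weight among all elements y ∈ A such that π(y_1),…,π(y_{i−1}),π(y) are linearly independent over R/I. Then {y_1,…,y_t} is a minimal basis of A, i.e., it is a basis and its profile is ⪯ the profile of every basis of A. -/
/-- Over a local ring, a subset of a finite module generates it if and only if its image
modulo the maximal ideal spans over the residue field. -/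
theorem span_image_mk_maximalIdeal_eq_top_iff {R A : Type*} [CommRing R] [IsLocalRing R]
    [AddCommGroup A] [Module R A] [Module.Finite R A] (S : Set A) :
    Submodule.span (R ⧸ IsLocalRing.maximalIdeal R)
      (Submodule.Quotient.mk (p := (IsLocalRing.maximalIdeal R • ⊤ : Submodule R A)) '' S) = ⊤ ↔
      Submodule.span R S = ⊤ := by
  rw [← IsLocalRing.map_mkQ_eq_top (N := Submodule.span R S), Submodule.map_span,
    ← Submodule.restrictScalars_span R (R ⧸ IsLocalRing.maximalIdeal R)
      Ideal.Quotient.mk_surjective, Submodule.restrictScalars_eq_top_iff]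
  rfl

/-- A minimal family among those with spanning image has linearly independent image. -/
theorem linearIndepOn_of_irredundant {K V A : Type*} [Field K] [AddCommGroup V] [Module K V]
    {π : A → V} {B : Finset A} (hspan : Submodule.span K (π '' B) = ⊤)
    (hmin : ∀ T : Finset A, T ⊂ B → Submodule.span K (π '' T) ≠ ⊤) :
    LinearIndepOn K π (B : Set A) := by
  obtain ⟨b, hbB, -, hspan', hb⟩ := exists_linearIndepOn_extension
    (linearIndepOn_empty K π) (Set.empty_subset (B : Set A))
  lift b to Finset A using B.finite_toSet.subset hbB
  have hle : b ⊆ B := by exact_mod_cast hbB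
  have htop : Submodule.span K (π '' b) = ⊤ :=
    top_le_iff.mp (hspan ▸ Submodule.span_le.mpr hspan')
  rcases hle.eq_or_ssubset with rfl | hlt
  · exact hb
  · exact absurd htop (hmin b hlt)

/-- The profile of the range of an injective family with monotone weights is its list of
weights. -/
theorem weightProfile_image_eq_ofFn {A : Type*} [DecidableEq A] (w : A → ℕ) {n : ℕ}
    {f : Fin n → A} (hf : Function.Injective f) (hmono : Monotone (w ∘ f)) :
    weightProfile w (Finset.image f Finset.univ) = List.ofFn (w ∘ f) := by
  refine List.Perm.eq_of_pairwise' (r := (· ≤ ·)) (Multiset.pairwise_sort _ _)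
    hmono.sortedLE_ofFn.pairwise (Multiset.coe_eq_coe.mp ?_)
  rw [weightProfile, Multiset.sort_eq, Finset.image_val_of_injOn hf.injOn, Multiset.map_map,
    List.ofFn_eq_map]
  rfl

/-- Every finite set can be enumerated with non-decreasing weights. -/
theorem Finset.exists_enumeration_monotone {A : Type*} [DecidableEq A] (w : A → ℕ)
    (B : Finset A) :
    ∃ b : Fin B.card → A,
      Function.Injective b ∧ Finset.image b Finset.univ = B ∧ Monotone (w ∘ b) := by
  let e : Fin B.card → A := fun i => B.equivFin.symm i
  let σ := Tuple.sort (w ∘ e)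
  have hinj : Function.Injective (e ∘ σ) :=
    (Subtype.val_injective.comp B.equivFin.symm.injective).comp σ.injective
  refine ⟨e ∘ σ, hinj, Finset.eq_of_subset_of_card_le ?_ ?_, Tuple.monotone_sort (w ∘ e)⟩
  · exact Finset.image_subset_iff.mpr fun i _ => (B.equivFin.symm (σ i)).2
  · simp [Finset.card_image_of_injective _ hinj]

/-- Among the first `i + 1` members of a linearly independent family, some member extends
a given linearly independent family of length `i`. -/
theorem LinearIndependent.exists_finSnoc {K V : Type*} [Field K] [AddCommGroup V] [Module K V]
    {n i : ℕ} {v : Fin i → V} (hv : LinearIndependent K v) {u : Fin n → V}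
    (hu : LinearIndependent K u) (hi : i < n) :
    ∃ j : Fin n, j ≤ ⟨i, hi⟩ ∧
      LinearIndependent K (Fin.snoc v (u j) : Fin (i + 1) → V) := by
  by_contra! h
  have hmem (j : Fin (i + 1)) : u (Fin.castLE hi j) ∈ Submodule.span K (Set.range v) := by
    by_contra hj
    exact h (Fin.castLE hi j) (Nat.le_of_lt_succ j.isLt) (linearIndependent_finSnoc.mpr ⟨hv, hj⟩)
  have hu' : LinearIndependent K fun j : Fin (i + 1) => u (Fin.castLE hi j) :=
    hu.comp _ (Fin.castLE_injective hi)
  have := FiniteDimensional.span_of_finite K (Set.finite_range v)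
  have hle := Submodule.finrank_mono
    (Submodule.span_le.mpr (Set.range_subset_iff.mpr hmem))
  rw [finrank_span_eq_card hu', finrank_span_eq_card hv] at hle
  simp at hle


/-- The greedy algorithm for a map `π` to a finite-dimensional vector space such that the
generating sets of `A` are the sets with spanning image under `π`. -/
theorem isBasisSet_and_profile_le_of_greedy {R A K V : Type*} [CommRing R] [AddCommGroup A]
    [Module R A] [DecidableEq A] [Field K] [AddCommGroup V] [Module K V] [Module.Finite K V]
    {π : A → V}
    (hspan : ∀ S : Set A, Submodule.span K (π '' S) = ⊤ ↔ Submodule.span R S = ⊤)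
    (w : A → ℕ) {t : ℕ} (ht : t = Module.finrank K V) {y : Fin t → A}
    (hindep : LinearIndependent K fun i => π (y i))
    (hgreedy : ∀ (i : Fin t) (y' : A),
      LinearIndependent K (Fin.snoc (fun j : Fin (i : ℕ) => π (y (Fin.castLE i.isLt.le j)))
        (π y') : Fin (i + 1) → V) → w (y i) ≤ w y') :
    Function.Injective y ∧ IsBasisSet R (Finset.image y Finset.univ) ∧
      ∀ B : Finset A, IsBasisSet R B →
        List.Forall₂ (· ≤ ·) (weightProfile w (Finset.image y Finset.univ))
          (weightProfile w B) := by
  have hinj : Function.Injective y := hindep.injective.of_comp (f := π)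
  have hprefix (i : Fin t) :
      LinearIndependent K fun j : Fin (i : ℕ) => π (y (Fin.castLE i.isLt.le j)) :=
    hindep.comp _ (Fin.castLE_injective i.isLt.le)
  have hmono : Monotone (w ∘ y) := by
    intro i j hij
    refine hgreedy i (y j) (linearIndependent_finSnoc.mpr ⟨hprefix i, fun hmem => ?_⟩)
    refine hindep.notMem_span_image (s := {k | k < i}) (x := j) (by simpa using hij)
      (Submodule.span_mono ?_ hmem)
    rintro _ ⟨k, rfl⟩
    exact ⟨Fin.castLE i.isLt.le k, k.isLt, rfl⟩
  refine ⟨hinj, ⟨?_, fun T hT hTtop => ?_⟩, fun B hB => ?_⟩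
  · rw [← hspan, Finset.coe_image, Finset.coe_univ, Set.image_univ, ← Set.range_comp]
    exact hindep.span_eq_top_of_card_eq_finrank' (by simpa using ht)
  · rw [← hspan] at hTtop
    have hcard := Finset.card_lt_card hT
    rw [Finset.card_image_of_injective _ hinj, Finset.card_univ, Fintype.card_fin, ht] at hcard
    classical
    have hle := finrank_span_finset_le_card (R := K) (T.image π)
    rw [Set.finrank, Finset.coe_image, hTtop, finrank_top] at hle
    exact absurd (hle.trans Finset.card_image_le) hcard.not_ge
  · have hBspan := (hspan B).mpr hB.1
    have hBindep : LinearIndepOn K π (B : Set A) :=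
      linearIndepOn_of_irredundant hBspan fun T hT => (hspan T).not.mpr (hB.2 T hT)
    have hcard : B.card = t := by
      rw [ht, ← finrank_top, ← hBspan, Set.image_eq_range]
      exact ((finrank_span_eq_card hBindep).trans (Fintype.card_coe B)).symm
    subst hcard
    obtain ⟨b, hb, hbB, hbmono⟩ := B.exists_enumeration_monotone w
    have hbindep : LinearIndependent K (π ∘ b) :=
      hBindep.comp (fun i => ⟨b i, hbB ▸ Finset.mem_image_of_mem b (Finset.mem_univ i)⟩)
        fun i j hij => hb (congrArg Subtype.val hij)
    have hprofile := weightProfile_image_eq_ofFn w hb hbmono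
    rw [hbB] at hprofile
    rw [weightProfile_image_eq_ofFn w hinj hmono, hprofile, List.forall₂_iff_get]
    refine ⟨by simp, fun i hi _ => ?_⟩
    have hi' : i < B.card := by simpa using hi
    obtain ⟨j, hj, hsnoc⟩ := (hprefix ⟨i, hi'⟩).exists_finSnoc hbindep hi'
    simpa using (hgreedy ⟨i, hi'⟩ (b j) hsnoc).trans (hbmono hj)

/-- The greedy algorithm produces a minimal basis: if `y_1, …, y_t`
(`t = dim_{R/I}(A/IA)`) are chosen so that their images in `A/IA` are linearly
independent over `R/I` and each `y_i` has minimal weight among all elements whose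
image extends the images of `y_1, …, y_{i-1}` to a linearly independent family, then
`{y_1, …, y_t}` is a basis of `A` whose profile is componentwise less than or equal
to the profile of every basis of `A`. -/
theorem stmt2 {R A : Type*} [CommRing R] [IsLocalRing R] [AddCommGroup A] [Module R A]
    [Module.Finite R A] [DecidableEq A] (w : A → ℕ) (t : ℕ)
    (ht : t = Module.finrank (R ⧸ IsLocalRing.maximalIdeal R)
      (A ⧸ ((IsLocalRing.maximalIdeal R) • ⊤ : Submodule R A)))
    (y : Fin t → A)
    (hindep : LinearIndependent (R ⧸ IsLocalRing.maximalIdeal R)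
      (fun i : Fin t =>
        Submodule.Quotient.mk (p := ((IsLocalRing.maximalIdeal R) • ⊤ : Submodule R A)) (y i)))
    (hgreedy : ∀ (i : Fin t) (y' : A),
      LinearIndependent (R ⧸ IsLocalRing.maximalIdeal R)
        (Fin.snoc
          (fun j : Fin (i : ℕ) =>
            Submodule.Quotient.mk (p := ((IsLocalRing.maximalIdeal R) • ⊤ : Submodule R A))
              (y (Fin.castLE i.isLt.le j)))
          (Submodule.Quotient.mk (p := ((IsLocalRing.maximalIdeal R) • ⊤ : Submodule R A)) y')) →
      w (y i) ≤ w y') :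
    Function.Injective y ∧ IsBasisSet R (Finset.image y Finset.univ) ∧
      ∀ B : Finset A, IsBasisSet R B →
        List.Forall₂ (· ≤ ·) (weightProfile w (Finset.image y Finset.univ))
          (weightProfile w B) := by
  let : Field (R ⧸ IsLocalRing.maximalIdeal R) := Ideal.Quotient.field _
  have : Module.Finite (R ⧸ IsLocalRing.maximalIdeal R)
      (A ⧸ (IsLocalRing.maximalIdeal R • ⊤ : Submodule R A)) :=
    Module.Finite.of_restrictScalars_finite R _ _
  exact isBasisSet_and_profile_le_of_greedy
    (K := R ⧸ IsLocalRing.maximalIdeal R)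
    (V := A ⧸ (IsLocalRing.maximalIdeal R • ⊤ : Submodule R A))
    span_image_mk_maximalIdeal_eq_top_iff w ht hindep hgreedy
end

section
/- Let p be a prime and a_1,…,a_r ≥ 1 integers. Let Code be a subgroup of G := (ℤ/p^{a_1}ℤ) × … × (ℤ/p^{a_r}ℤ), let π : ℤ^r → G be the componentwise reduction map, and let L := π^{−1}(Code), a free ℤ-module of rank r. For y = (y_1,…,y_r) ∈ G set W(y) := ∏_{i=1}^r ord(y_i), the product of the additive orders of the coordinates of y, so that W(y) = p^{w(y)} where w is the Hamming weight. Let z_1,…,z_t be a minimal basis of Code with respect to w. Then the minimum, over all ℤ-bases x_1,…,x_r of L, of W(π(x_1)) + … + W(π(x_r)) equals W(z_1) + … + W(z_t) + r − t, i.e., equals p^{w(z_1)} + … + p^{w(z_t)} + r − t. -/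
/-- The componentwise reduction map `ℤ^r → (ℤ/p^{a_1}ℤ) × … × (ℤ/p^{a_r}ℤ)`,
as a `ℤ`-linear map. -/
def codeProj (p : ℕ) {r : ℕ} (a : Fin r → ℕ) :
    (Fin r → ℤ) →ₗ[ℤ] (Π i, ZMod (p ^ a i)) :=
  LinearMap.pi fun i =>
    ((Int.castRingHom (ZMod (p ^ a i))).toAddMonoidHom.toIntLinearMap).comp
      (LinearMap.proj i)

/-- `W(y)`: the product of the additive orders of the coordinates of `y`.
It equals `p^{w(y)}` where `w` is the Hamming weight. -/
noncomputable def codeW {p r : ℕ} {a : Fin r → ℕ} (y : Π i, ZMod (p ^ a i)) : ℕ :=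
  ∏ i, addOrderOf (y i)

/-- The Hamming weight `w(y)`, recovered from `W(y) = p^{w(y)}` as the `p`-adic
valuation of `W(y)`. -/
noncomputable def hammingWt (p : ℕ) {r : ℕ} {a : Fin r → ℕ}
    (y : Π i, ZMod (p ^ a i)) : ℕ :=
  (codeW y).factorization p

/-- A *basis* of a code (a subgroup `H`): an injective family of elements of `H`
generating `H`, no proper subset of which generates `H`. -/
def IsCodeBasis {G : Type*} [AddCommGroup G] (H : AddSubgroup G) {t : ℕ}
    (z : Fin t → G) : Prop :=
  Function.Injective z ∧ (∀ j, z j ∈ H) ∧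
    AddSubgroup.closure (Set.range z) = H ∧
    ∀ S : Set G, S ⊂ Set.range z → AddSubgroup.closure S ≠ H

/-- The profile of a family: its weights sorted in non-decreasing order. -/
noncomputable def famProfile {G : Type*} (w : G → ℕ) {t : ℕ} (z : Fin t → G) : List ℕ :=
  ((List.ofFn fun j => w (z j)) : Multiset ℕ).sort (· ≤ ·)

open Module in
/-- Adding to one basis vector a combination of the other ones gives a basis again. -/
theorem Module.Basis.exists_add_to_vector {R M ι : Type*} [CommRing R] [AddCommGroup M]
    [Module R M] (b : Basis ι R M) (j : ι) (x : M) (hx : b.repr x j = 0) :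
    ∃ b' : Basis ι R M, b' j = b j + x ∧ ∀ i, i ≠ j → b' i = b i := by
  classical
  have h : b.coord j x = 0 := hx
  refine ⟨b.map (LinearEquiv.transvection h), ?_, fun i hi => ?_⟩
  · simp [LinearMap.transvection.apply]
  · simp [LinearMap.transvection.apply, hi]

/-- Nakayama's lemma for a group killed by a power of `p`: the members of a basis are independent
modulo `p`. -/
theorem IsCodeBasis.ne_add_smul {M : Type*} [AddCommGroup M] {H : AddSubgroup M} {t : ℕ}
    {z : Fin t → M} (hz : IsCodeBasis H z) {p N : ℕ} (hN : ∀ x ∈ H, p ^ N • x = 0)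
    (k : Fin t) {n y : M} (hn : n ∈ AddSubgroup.closure (z '' {k}ᶜ)) (hy : y ∈ H) :
    z k ≠ n + p • y := by
  intro hk
  obtain ⟨hinj, hmem, hgen, hirr⟩ := hz
  set K := AddSubgroup.closure (z '' {k}ᶜ) with hK
  have hss : z '' {k}ᶜ ⊂ Set.range z := by
    refine ⟨Set.image_subset_range _ _, fun h => ?_⟩
    obtain ⟨i, hi, hik⟩ := h ⟨k, rfl⟩
    exact hi (hinj hik)
  refine hirr _ hss (le_antisymm ?_ ?_)
  · rw [← hgen]; exact AddSubgroup.closure_mono hss.1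
  have step : ∀ x ∈ H, ∃ n ∈ K, ∃ y ∈ H, x = n + p • y := by
    intro x hx
    rw [← hgen] at hx
    induction hx using AddSubgroup.closure_induction with
    | mem x hx =>
      obtain ⟨i, rfl⟩ := hx
      by_cases hi : i = k
      · subst hi; exact ⟨n, hn, y, hy, hk⟩
      · exact ⟨z i, AddSubgroup.subset_closure ⟨i, hi, rfl⟩, 0, H.zero_mem, by simp⟩
    | zero => exact ⟨0, K.zero_mem, 0, H.zero_mem, by simp⟩
    | add x x' _ _ h h' =>
      obtain ⟨n, hn, y, hy, rfl⟩ := h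
      obtain ⟨n', hn', y', hy', rfl⟩ := h'
      exact ⟨n + n', K.add_mem hn hn', y + y', H.add_mem hy hy', by rw [smul_add]; abel⟩
    | neg x _ h =>
      obtain ⟨n, hn, y, hy, rfl⟩ := h
      exact ⟨-n, K.neg_mem hn, -y, H.neg_mem hy, by rw [smul_neg]; abel⟩
  have iter : ∀ m : ℕ, ∀ x ∈ H, ∃ n ∈ K, ∃ y ∈ H, x = n + p ^ m • y := by
    intro m
    induction m with
    | zero => exact fun x hx => ⟨0, K.zero_mem, x, hx, by simp⟩
    | succ m ih =>
      intro x hx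
      obtain ⟨n, hn, y, hy, rfl⟩ := ih x hx
      obtain ⟨n', hn', y', hy', rfl⟩ := step y hy
      exact ⟨n + p ^ m • n', K.add_mem hn (K.nsmul_mem hn' _), y', hy', by
        rw [smul_add, ← mul_smul, ← pow_succ]; abel⟩
  intro x hx
  obtain ⟨n, hn, y, hy, rfl⟩ := iter N x hx
  rw [hN y hy, add_zero]; exact hn

open Module in
/-- Steinitz exchange modulo `p`: a basis of a free group `L` mapping onto `H` can be modified so
that distinct members are sent to prescribed basis elements of `H`, up to units. -/
theorem IsCodeBasis.exists_basis_lift {L M ι : Type*} [AddCommGroup L] [AddCommGroup M]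
    [Fintype ι] (φ : L →ₗ[ℤ] M) (b : Basis ι ℤ L) {H : AddSubgroup M} {t : ℕ} {z : Fin t → M}
    (hφ : ∀ x, x ∈ H ↔ ∃ l, φ l = x)
    (hz : IsCodeBasis H z) {p N : ℕ} (hp : p.Prime) (hN : ∀ x ∈ H, p ^ N • x = 0)
    (S : Finset (Fin t)) :
    ∃ (b' : Basis ι ℤ L) (f : Fin t → ι), Set.InjOn f S ∧
      ∀ i ∈ S, ∃ u v : ℤ, φ (b' (f i)) = u • z i ∧ z i = v • φ (b' (f i)) := by
  classical
  have exists_coprime : ∀ (b' : Basis ι ℤ L) (T : Finset ι) (k : Fin t),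
      (∀ j ∈ T, φ (b' j) ∈ AddSubgroup.closure (z '' {k}ᶜ)) → ∀ l, φ l = z k →
      ∃ j, j ∉ T ∧ ¬ (p : ℤ) ∣ b'.repr l j := by
    intro b' T k hT l hl
    by_contra! hcon
    have hdec : ∀ j, ∃ n ∈ AddSubgroup.closure (z '' {k}ᶜ), ∃ y ∈ H,
        b'.repr l j • φ (b' j) = n + p • y := by
      intro j
      by_cases hj : j ∈ T
      · exact ⟨_, AddSubgroup.zsmul_mem _ (hT j hj) _, 0, H.zero_mem,
          by rw [smul_zero, add_zero]⟩
      · obtain ⟨c, hc⟩ := hcon j hj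
        refine ⟨0, AddSubgroup.zero_mem _, c • φ (b' j),
          H.zsmul_mem ((hφ _).2 ⟨_, rfl⟩) _, ?_⟩
        rw [hc, zero_add, mul_smul, natCast_zsmul]
    choose n hn y hy hny using hdec
    refine hz.ne_add_smul hN k (AddSubgroup.sum_mem _ fun j (_ : j ∈ Finset.univ) => hn j)
      (H.sum_mem fun j (_ : j ∈ Finset.univ) => hy j) ?_
    rw [Finset.smul_sum, ← Finset.sum_add_distrib, ← hl]
    conv_lhs => rw [← b'.sum_repr l, map_sum]
    exact Finset.sum_congr rfl fun j _ => by rw [map_smul, hny]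
  induction S using Finset.induction_on with
  | empty =>
    rcases isEmpty_or_nonempty (Fin t) with h | ⟨⟨k⟩⟩
    · exact ⟨b, fun i => isEmptyElim i, by simp, by simp⟩
    · obtain ⟨l, hl⟩ := (hφ _).1 (hz.2.1 k)
      obtain ⟨j, -⟩ := exists_coprime b ∅ k (by simp) l hl
      exact ⟨b, fun _ => j, by simp, by simp⟩
  | insert k S hk ih =>
    obtain ⟨b, f, hf, hS⟩ := ih
    obtain ⟨l, hl⟩ := (hφ _).1 (hz.2.1 k)
    have hik : ∀ i ∈ S, i ≠ k := fun i hi h => hk (h ▸ hi)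
    obtain ⟨j, hj, hpj⟩ := exists_coprime b (S.image f) k (by
      intro j hj
      obtain ⟨i, hi, rfl⟩ := Finset.mem_image.1 hj
      obtain ⟨u, -, hu, -⟩ := hS i hi
      rw [hu]
      exact AddSubgroup.zsmul_mem _ (AddSubgroup.subset_closure
        (Set.mem_image_of_mem z (hik i hi))) _) l hl
    have hco : IsCoprime (b.repr l j) ((p : ℤ) ^ N) :=
      ((Nat.prime_iff_prime_int.1 hp).coprime_iff_not_dvd.2 hpj).symm.pow_right
    obtain ⟨v, w, hvw⟩ := hco
    have key : ∀ x ∈ H, (v * b.repr l j) • x = x := by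
      intro x hx
      have : v * b.repr l j = 1 - w * (p : ℤ) ^ N := by linarith
      rw [this, sub_smul, mul_smul]
      have h0 := hN x hx
      rw [← natCast_zsmul] at h0
      push_cast at h0
      rw [h0]; simp
    have hbj : φ (b j) ∈ H := (hφ _).2 ⟨_, rfl⟩
    obtain ⟨b', hb'j, hb'⟩ := b.exists_add_to_vector j (v • (l - b.repr l j • b j)) (by simp)
    have hval : φ (b' j) = v • z k := by
      rw [hb'j, map_add, map_smul, map_sub, map_smul, smul_sub, ← mul_smul, key _ hbj, hl]
      abel
    have hne : ∀ i ∈ S, f i ≠ j := fun i hi h => hj (Finset.mem_image.2 ⟨i, hi, h⟩)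
    refine ⟨b', Function.update f k j, ?_, ?_⟩
    · rw [Finset.coe_insert, Set.injOn_insert (by simpa using hk)]
      refine ⟨fun i hi i' hi' h => hf hi hi' ?_, ?_⟩
      · rwa [Function.update_of_ne (hik i hi), Function.update_of_ne (hik i' hi')] at h
      · rintro ⟨i, hi, h⟩
        rw [Function.update_of_ne (hik i hi), Function.update_self] at h
        exact hne i hi h
    · intro i hi
      rcases Finset.mem_insert.1 hi with rfl | hi
      · rw [Function.update_self, hval]
        refine ⟨v, b.repr l j, rfl, ?_⟩
        rw [← mul_smul, mul_comm, key _ (hz.2.1 i)]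
      · rw [Function.update_of_ne (hik i hi), hb' _ (hne i hi)]
        exact hS i hi

open Module in
/-- The lifted basis can moreover be chosen so that the remaining members map to zero. -/
theorem IsCodeBasis.exists_basis_lift_and_zero {L M ι : Type*} [AddCommGroup L] [AddCommGroup M]
    [Fintype ι] (φ : L →ₗ[ℤ] M) (b : Basis ι ℤ L) {H : AddSubgroup M} {t : ℕ} {z : Fin t → M}
    (hφ : ∀ x, x ∈ H ↔ ∃ l, φ l = x)
    (hz : IsCodeBasis H z) {p N : ℕ} (hp : p.Prime) (hN : ∀ x ∈ H, p ^ N • x = 0) :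
    ∃ (b' : Basis ι ℤ L) (f : Fin t → ι), Function.Injective f ∧
      (∀ i, ∃ u v : ℤ, φ (b' (f i)) = u • z i ∧ z i = v • φ (b' (f i))) ∧
      ∀ j, (∀ i, f i ≠ j) → φ (b' j) = 0 := by
  classical
  obtain ⟨b, f, hf, hb⟩ := hz.exists_basis_lift φ b hφ hp hN Finset.univ
  rw [Finset.coe_univ, Set.injOn_univ] at hf
  suffices h : ∀ T : Finset ι, ∃ b' : Basis ι ℤ L, (∀ i, b' (f i) = b (f i)) ∧
      ∀ j ∈ T, (∀ i, f i ≠ j) → φ (b' j) = 0 by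
    obtain ⟨b', h1, h2⟩ := h Finset.univ
    exact ⟨b', f, hf, fun i => by rw [h1]; exact hb i (Finset.mem_univ i),
      fun j => h2 j (Finset.mem_univ j)⟩
  intro T
  induction T using Finset.induction_on with
  | empty => exact ⟨b, by simp, by simp⟩
  | insert k T _ ih =>
    obtain ⟨b₁, h1, h2⟩ := ih
    by_cases hk : ∀ i, f i ≠ k
    · have hspan : φ (b₁ k) ∈ (Submodule.span ℤ (Set.range fun i => b₁ (f i))).map φ := by
        have hle : H ≤ ((Submodule.span ℤ (Set.range fun i => b₁ (f i))).map φ).toAddSubgroup := by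
          rw [← hz.2.2.1, AddSubgroup.closure_le]
          rintro _ ⟨i, rfl⟩
          obtain ⟨-, v, -, hv⟩ := hb i (Finset.mem_univ i)
          refine ⟨v • b₁ (f i), Submodule.smul_mem _ _ (Submodule.subset_span ⟨i, rfl⟩), ?_⟩
          rw [map_smul, h1, ← hv]
        exact hle ((hφ _).2 ⟨_, rfl⟩)
      obtain ⟨x, hx, hxk⟩ := hspan
      have hcoord : b₁.repr (-x) k = 0 := by
        have hle : Submodule.span ℤ (Set.range fun i => b₁ (f i)) ≤
            LinearMap.ker (b₁.coord k) := by
          rw [Submodule.span_le]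
          rintro _ ⟨i, rfl⟩
          simp [hk i]
        have := hle hx
        simpa using this
      obtain ⟨b₂, hk2, hb2⟩ := b₁.exists_add_to_vector k (-x) hcoord
      refine ⟨b₂, fun i => by rw [hb2 _ (hk i), h1], fun j hj hfj => ?_⟩
      by_cases hjk : j = k
      · subst hjk
        rw [hk2, map_add, map_neg, hxk, add_neg_cancel]
      · rw [hb2 _ hjk]
        exact h2 j (Finset.mem_of_mem_insert_of_ne hj hjk) hfj
    · refine ⟨b₁, h1, fun j hj hfj => ?_⟩
      rcases Finset.mem_insert.1 hj with rfl | hj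
      · exact absurd hfj hk
      · exact h2 j hj hfj

/-- A basis has at most as many elements as any finite generating family. -/
theorem IsCodeBasis.card_le_of_closure_eq {M : Type*} [AddCommGroup M] {H : AddSubgroup M}
    {s t : ℕ} {z : Fin t → M} (hz : IsCodeBasis H z) {p N : ℕ} (hp : p.Prime)
    (hN : ∀ x ∈ H, p ^ N • x = 0) (y : Fin s → M)
    (hy : AddSubgroup.closure (Set.range y) = H) : t ≤ s := by
  have hφ : ∀ x, x ∈ H ↔ ∃ l, Fintype.linearCombination ℤ y l = x := by
    intro x
    rw [← hy, ← LinearMap.mem_range, Fintype.range_linearCombination,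
      ← Submodule.mem_toAddSubgroup, Submodule.span_int_eq_addSubgroupClosure]
  obtain ⟨-, f, hf, -⟩ := hz.exists_basis_lift_and_zero _ (Pi.basisFun ℤ (Fin s)) hφ hp hN
  simpa using Fintype.card_le_of_injective f hf

/-- Every finite generating family contains a basis. -/
theorem exists_isCodeBasis_of_closure_eq {M ι : Type*} [AddCommGroup M] [Finite ι]
    {H : AddSubgroup M} (y : ι → M) (hy : AddSubgroup.closure (Set.range y) = H) :
    ∃ (s : ℕ) (f : Fin s → ι), Function.Injective f ∧ IsCodeBasis H (y ∘ f) := by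
  classical
  cases nonempty_fintype ι
  obtain ⟨T, hT⟩ := (Finset.univ.filter fun T : Finset ι =>
    AddSubgroup.closure (y '' T) = H).exists_minimal ⟨Finset.univ, by simpa using hy⟩
  simp only [Finset.mem_filter, Finset.mem_univ, true_and] at hT
  have hrange : Set.range (y ∘ fun j => (T.equivFin.symm j : ι)) = y '' T := by
    ext x
    constructor
    · rintro ⟨j, rfl⟩
      exact ⟨_, (T.equivFin.symm j).2, rfl⟩
    · rintro ⟨i, hi, rfl⟩
      exact ⟨T.equivFin ⟨i, hi⟩, by simp⟩
  have hinj : Set.InjOn y T := by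
    intro i hi j hj hij
    by_contra hne
    have himg : y '' (T.erase i : Finset ι) = y '' T := by
      refine (Set.image_mono (by simp)).antisymm ?_
      rintro _ ⟨k, hk, rfl⟩
      by_cases hki : k = i
      · exact ⟨j, Finset.mem_erase.2 ⟨Ne.symm hne, hj⟩, by rw [hki, hij]⟩
      · exact ⟨k, Finset.mem_erase.2 ⟨hki, hk⟩, rfl⟩
    have hle : T ≤ T.erase i := hT.2 ((congrArg _ himg).trans hT.1) (Finset.erase_subset i T)
    exact Finset.notMem_erase i T (hle hi)
  refine ⟨T.card, fun j => T.equivFin.symm j,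
    Subtype.val_injective.comp T.equivFin.symm.injective, ?_, ?_, ?_, ?_⟩
  · intro j j' h
    exact T.equivFin.symm.injective
      (Subtype.ext (hinj (T.equivFin.symm j).2 (T.equivFin.symm j').2 h))
  · intro j
    rw [← hy]
    exact AddSubgroup.subset_closure ⟨_, rfl⟩
  · rw [hrange]
    exact hT.1
  · rw [hrange]
    intro S hS hSH
    have himg : y '' (T.filter (y · ∈ S) : Finset ι) = S := by
      ext x
      constructor
      · rintro ⟨i, hi, rfl⟩
        exact (Finset.mem_filter.1 hi).2
      · intro hx
        obtain ⟨i, hi, rfl⟩ := hS.1 hx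
        exact ⟨i, Finset.mem_filter.2 ⟨hi, hx⟩, rfl⟩
    have hle : T ≤ T.filter (y · ∈ S) := hT.2 ((congrArg _ himg).trans hSH)
      (Finset.filter_subset _ _)
    refine hS.2 ?_
    rintro _ ⟨i, hi, rfl⟩
    exact (Finset.mem_filter.1 (hle hi)).2

section Weight

variable {p r : ℕ} {a : Fin r → ℕ}

theorem pow_sum_nsmul_eq_zero (y : Π i, ZMod (p ^ a i)) : p ^ (∑ i, a i) • y = 0 := by
  funext i
  have h : ((p ^ (∑ i, a i) : ℕ) : ZMod (p ^ a i)) = 0 :=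
    (ZMod.natCast_eq_zero_iff _ _).2
      (pow_dvd_pow p (Finset.single_le_sum (fun _ _ => Nat.zero_le _) (Finset.mem_univ i)))
  rw [Pi.smul_apply, nsmul_eq_mul, h, zero_mul, Pi.zero_apply]

theorem codeW_dvd (y : Π i, ZMod (p ^ a i)) : codeW y ∣ p ^ (∑ i, a i) := by
  rw [codeW, ← Finset.prod_pow_eq_pow_sum]
  refine Finset.prod_dvd_prod_of_dvd _ _ fun i _ => addOrderOf_dvd_of_nsmul_eq_zero ?_
  rw [nsmul_eq_mul, ZMod.natCast_self, zero_mul]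

theorem codeW_eq_pow_hammingWt (hp : p.Prime) (y : Π i, ZMod (p ^ a i)) :
    codeW y = p ^ hammingWt p y := by
  obtain ⟨k, -, hk⟩ := (Nat.dvd_prime_pow hp).1 (codeW_dvd y)
  rw [hammingWt, hk, Nat.factorization_pow_self hp]

theorem one_le_codeW (hp : p.Prime) (y : Π i, ZMod (p ^ a i)) : 1 ≤ codeW y :=
  Nat.pos_of_dvd_of_pos (codeW_dvd y) (pow_pos hp.pos _)

@[simp]
theorem codeW_zero : codeW (0 : Π i, ZMod (p ^ a i)) = 1 := by
  simp [codeW]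

theorem codeW_zsmul_dvd (u : ℤ) (y : Π i, ZMod (p ^ a i)) : codeW (u • y) ∣ codeW y :=
  Finset.prod_dvd_prod_of_dvd _ _ fun _ _ =>
    addOrderOf_dvd_of_mem_zmultiples (AddSubgroup.zsmul_mem_zmultiples _ u)

/-- If the sorted weights of `z` are dominated by those of `z'`, then so are the sums of `W`. -/
theorem sum_codeW_le_of_famProfile (hp : p.Prime) {t : ℕ} {z z' : Fin t → Π i, ZMod (p ^ a i)}
    (h : List.Forall₂ (· ≤ ·) (famProfile (hammingWt p) z) (famProfile (hammingWt p) z')) :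
    ∑ j, codeW (z j) ≤ ∑ j, codeW (z' j) := by
  have hsum : ∀ y : Fin t → Π i, ZMod (p ^ a i),
      ∑ j, codeW (y j) = ((famProfile (hammingWt p) y).map (p ^ ·)).sum := by
    intro y
    rw [← Multiset.sum_coe, ← Multiset.map_coe, famProfile, Multiset.sort_eq, Multiset.map_coe,
      Multiset.sum_coe, List.map_ofFn, List.sum_ofFn]
    exact Finset.sum_congr rfl fun j _ => codeW_eq_pow_hammingWt hp _
  rw [hsum, hsum]
  refine List.Forall₂.sum_le_sum ?_
  rw [List.forall₂_map_left_iff, List.forall₂_map_right_iff]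
  exact h.imp fun _ _ hab => Nat.pow_le_pow_right hp.pos hab

end Weight

theorem codeProj_surjective (p : ℕ) {r : ℕ} (a : Fin r → ℕ) :
    Function.Surjective (codeProj p a) := by
  intro y
  choose l hl using fun i => ZMod.intCast_surjective (y i)
  exact ⟨l, funext hl⟩

/-- Separating the values on the image of an injection from the others, which are at least one. -/
theorem Finset.sum_comp_add_card_sub_le {r t : ℕ} {f : Fin t → Fin r} (hf : Function.Injective f)
    (g : Fin r → ℕ) (hg : ∀ j, 1 ≤ g j) : ∑ i, g (f i) + (r - t) ≤ ∑ j, g j := by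
  classical
  have hcard : (Finset.univ \ Finset.univ.image f).card = r - t := by
    rw [Finset.card_sdiff_of_subset (Finset.subset_univ _),
      Finset.card_image_of_injective _ hf, Finset.card_fin, Finset.card_fin]
  rw [← Finset.sum_sdiff (Finset.subset_univ (Finset.univ.image f)),
    Finset.sum_image hf.injOn, add_comm, ← hcard, Finset.card_eq_sum_ones]
  gcongr
  exact hg _

theorem Finset.sum_eq_sum_comp_add_card_sub {r t : ℕ} {f : Fin t → Fin r}
    (hf : Function.Injective f) (g : Fin r → ℕ) (hg : ∀ j, (∀ i, f i ≠ j) → g j = 1) :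
    ∑ j, g j = ∑ i, g (f i) + (r - t) := by
  classical
  have hcard : (Finset.univ \ Finset.univ.image f).card = r - t := by
    rw [Finset.card_sdiff_of_subset (Finset.subset_univ _),
      Finset.card_image_of_injective _ hf, Finset.card_fin, Finset.card_fin]
  rw [← Finset.sum_sdiff (Finset.subset_univ (Finset.univ.image f)),
    Finset.sum_image hf.injOn, add_comm, ← hcard, Finset.card_eq_sum_ones]
  congr 1
  refine Finset.sum_congr rfl fun j hj => hg j ?_
  simpa using hj

/-- If `z_1, …, z_t` is a minimal basis (with respect to the Hamming weight `w`) of a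
code `Code ⊆ (ℤ/p^{a_1}ℤ) × … × (ℤ/p^{a_r}ℤ)` and `L = π⁻¹(Code) ⊆ ℤ^r`, then the
minimum over all `ℤ`-bases `x_1, …, x_r` of `L` of `W(π(x_1)) + … + W(π(x_r))` equals
`W(z_1) + … + W(z_t) + r - t`, i.e. equals `p^{w(z_1)} + … + p^{w(z_t)} + r - t`. -/
theorem stmt6 (p : ℕ) (hp : p.Prime) (r : ℕ) (a : Fin r → ℕ) (ha : ∀ i, 1 ≤ a i)
    (Code : AddSubgroup (Π i, ZMod (p ^ a i)))
    (t : ℕ) (z : Fin t → (Π i, ZMod (p ^ a i)))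
    (hz : IsCodeBasis Code z)
    (hzmin : ∀ z' : Fin t → (Π i, ZMod (p ^ a i)), IsCodeBasis Code z' →
      List.Forall₂ (· ≤ ·) (famProfile (hammingWt p) z) (famProfile (hammingWt p) z')) :
    IsLeast
      { S : ℕ | ∃ x : Fin r → (Fin r → ℤ),
          LinearIndependent ℤ x ∧
          Submodule.span ℤ (Set.range x) =
            Submodule.comap (codeProj p a) (AddSubgroup.toIntSubmodule Code) ∧
          S = ∑ i, codeW (codeProj p a (x i)) }
      ((∑ j, codeW (z j)) + (r - t)) ∧
    (∑ j, codeW (z j)) + (r - t) = (∑ j, p ^ hammingWt p (z j)) + (r - t) := by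
  refine ⟨⟨?_, ?_⟩, by simp_rw [← codeW_eq_pow_hammingWt hp]⟩
  · have : ∀ i, NeZero (p ^ a i) := fun i => ⟨pow_ne_zero _ hp.ne_zero⟩
    set L := Submodule.comap (codeProj p a) (AddSubgroup.toIntSubmodule Code) with hL
    have hfin : Finite ((Fin r → ℤ) ⧸ L) :=
      Finite.of_injective (L.mapQ (AddSubgroup.toIntSubmodule Code) (codeProj p a) le_rfl) (by
        rw [← LinearMap.ker_eq_bot, Submodule.ker_mapQ, Submodule.mkQ_map_self])
    have hrank : Module.finrank ℤ L = r := by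
      rw [(Submodule.finiteQuotient_iff L).1 hfin, Module.finrank_fin_fun]
    have hφ : ∀ x, x ∈ Code ↔ ∃ l, ((codeProj p a).comp L.subtype) l = x := by
      intro x
      constructor
      · intro hx
        obtain ⟨l, rfl⟩ := codeProj_surjective p a x
        exact ⟨⟨l, hx⟩, rfl⟩
      · rintro ⟨l, rfl⟩
        exact l.2
    obtain ⟨b, f, hf, hbz, hb0⟩ := hz.exists_basis_lift_and_zero _
      (Module.finBasisOfFinrankEq ℤ L hrank) hφ hp (fun x _ => pow_sum_nsmul_eq_zero x)
    refine ⟨fun i => b i, ?_, ?_, ?_⟩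
    · exact b.linearIndependent.map' L.subtype (Submodule.ker_subtype L)
    · have : Set.range (fun i => (b i : Fin r → ℤ)) = L.subtype '' Set.range b := by
        rw [← Set.range_comp]; rfl
      rw [this, Submodule.span_image, b.span_eq, Submodule.map_top, Submodule.range_subtype]
    · rw [Finset.sum_eq_sum_comp_add_card_sub hf]
      · congr 1
        refine Finset.sum_congr rfl fun i _ => ?_
        obtain ⟨u, v, hu, hv⟩ := hbz i
        refine Nat.dvd_antisymm ?_ ?_
        · nth_rw 1 [hv]
          exact codeW_zsmul_dvd _ _
        · change codeW ((codeProj p a).comp L.subtype (b (f i))) ∣ _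
          rw [hu]
          exact codeW_zsmul_dvd _ _
      · intro j hj
        have h0 : codeProj p a (b j) = 0 := hb0 j hj
        rw [h0, codeW_zero]
  · rintro _ ⟨x, -, hx, rfl⟩
    have hgen : AddSubgroup.closure (Set.range fun i => codeProj p a (x i)) = Code := by
      have hmap := congrArg (Submodule.map (codeProj p a)) hx
      rw [Submodule.map_comap_eq_of_surjective (codeProj_surjective p a), Submodule.map_span,
        ← Set.range_comp] at hmap
      have := congrArg Submodule.toAddSubgroup hmap
      rwa [Submodule.span_int_eq_addSubgroupClosure] at this
    obtain ⟨s, f, hf, hbasis⟩ := exists_isCodeBasis_of_closure_eq _ hgen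
    have hN : ∀ x ∈ Code, p ^ (∑ i, a i) • x = 0 := fun x _ => pow_sum_nsmul_eq_zero x
    obtain rfl : s = t := le_antisymm (hbasis.card_le_of_closure_eq hp hN z hz.2.2.1)
      (hz.card_le_of_closure_eq hp hN _ hbasis.2.2.1)
    calc _ ≤ ∑ j, codeW (codeProj p a (x (f j))) + (r - s) :=
          Nat.add_le_add_right (sum_codeW_le_of_famProfile hp (hzmin _ hbasis)) _
      _ ≤ _ := Finset.sum_comp_add_card_sub_le hf (fun j => codeW (codeProj p a (x j)))
          fun j => one_le_codeW hp _
end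

section
/- Let K be a field of characteristic different from 2 and let d_1, d_2, d_3, d_4 ∈ K be nonzero elements whose product d_1d_2d_3d_4 is a square in K. Then there exist nonzero a, b, c ∈ K such that the diagonal quadratic form ⟨d_1, d_2, d_3, d_4⟩ is isometric to ⟨−b, c, ab, −ac⟩ over K. In other words, every 4-dimensional quadratic form of trivial discriminant over K arises as the form ⟨−b, c, ab, −ac⟩ associated to a pair of linked quaternion algebras (a,b) and (a,c). -/
/-- Over a field `K` of characteristic `≠ 2`, every 4-dimensional diagonal quadratic
form `⟨d_1, d_2, d_3, d_4⟩` with nonzero entries whose product is a square (i.e. of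
trivial discriminant) is isometric to a form `⟨-b, c, ab, -ac⟩` for some nonzero
`a, b, c ∈ K`. -/
theorem stmt8 {K : Type*} [Field K] (hK : (2 : K) ≠ 0) (d : Fin 4 → K)
    (hd : ∀ i, d i ≠ 0) (hsq : ∃ s : K, d 0 * d 1 * d 2 * d 3 = s ^ 2) :
    ∃ a b c : K, a ≠ 0 ∧ b ≠ 0 ∧ c ≠ 0 ∧
      QuadraticMap.Equivalent
        (QuadraticMap.weightedSumSquares K d)
        (QuadraticMap.weightedSumSquares K
          (![-b, c, a * b, -(a * c)] : Fin 4 → K)) := by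
  obtain ⟨s, hs⟩ := hsq
  have h0 := hd 0
  have h1 := hd 1
  have h2 := hd 2
  have h3 := hd 3
  have hs0 : s ≠ 0 := by
    rintro rfl
    simp [h0, h1, h2, h3] at hs
  refine ⟨-(d 2 / d 0), -d 0, d 1, neg_ne_zero.2 (div_ne_zero h2 h0), neg_ne_zero.2 h0, h1,
    ⟨QuadraticForm.isometryEquivWeightedSumSquaresWeightedSumSquares
      ![1, 1, 1, Units.mk0 (d 0 * d 3 / s) (div_ne_zero (mul_ne_zero h0 h3) hs0)] fun i ↦ ?_⟩⟩
  fin_cases i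
  · simp
  · simp
  · simp [h0]
  · simp only [Fin.reduceFinMk, Matrix.cons_val, Units.val_mk0]
    field_simp
    linear_combination hs
end
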